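/- arXiv:1609.05374 — 4 statements merged into one kernel-verified Lean document; each statement's English description precedes it below -/
import Mathlib

section
/- Let d be a positive integer, let u, w ∈ ℝ^d with u_i ≥ 0 and w_i > 0 for all i, let η ∈ ℝ and L ∈ ℝ^d, and define w̃ ∈ ℝ^d by w̃_i = w_i·exp(−η·L_i). Then ∑_{i=1}^d w_i·(1 − exp(−η·L_i)) = Δ(u‖w) − Δ(u‖w̃) + η·∑_{i=1}^d u_i·L_i. -/
/-- Unnormalized relative entropy between vectors, with the convention `0 * log 0 = 0`
(which holds automatically since `Real.log 0 = 0`). -/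
noncomputable def unnormRelEntropy {d : ℕ} (u w : Fin d → ℝ) : ℝ :=
  ∑ i, (u i * Real.log (u i / w i) + w i - u i)

theorem hedge_divergence_identity (d : ℕ) (hd : 0 < d)
    (u w : Fin d → ℝ) (hu : ∀ i, 0 ≤ u i) (hw : ∀ i, 0 < w i)
    (η : ℝ) (L : Fin d → ℝ)
    (wt : Fin d → ℝ) (hwt : ∀ i, wt i = w i * Real.exp (-η * L i)) :
    ∑ i, w i * (1 - Real.exp (-η * L i)) =
      unnormRelEntropy u w - unnormRelEntropy u wt + η * ∑ i, u i * L i := by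
  unfold unnormRelEntropy
  rw [Finset.mul_sum, ← Finset.sum_sub_distrib, ← Finset.sum_add_distrib]
  refine Finset.sum_congr rfl fun i _ => ?_
  rw [hwt i]
  rcases (hu i).eq_or_lt with h | h
  · rw [← h]
    ring
  · rw [Real.log_div h.ne' (hw i).ne',
      Real.log_div h.ne' (mul_pos (hw i) (Real.exp_pos _)).ne',
      Real.log_mul (hw i).ne' (Real.exp_pos _).ne', Real.log_exp]
    ring
end

section
/- Let d be a positive integer, let η > 0, let L ∈ [0,1]^d, let w ∈ ℝ^d with w_i > 0 for all i, let u ∈ ℝ^d with u_i ≥ 0 for all i, and define w̃ ∈ ℝ^d by w̃_i = w_i·exp(−η·L_i). Then (1 − exp(−η))·∑_{i=1}^d w_i·L_i ≤ Δ(u‖w) − Δ(u‖w̃) + η·∑_{i=1}^d u_i·L_i. -/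
/-- The chord of `x ↦ exp (-η * x)` over `[0, 1]` lies above the graph. -/
theorem exp_neg_mul_le_chord (η : ℝ) {x : ℝ} (hx : x ∈ Set.Icc (0 : ℝ) 1) :
    Real.exp (-η * x) ≤ 1 - (1 - Real.exp (-η)) * x := by
  have h := convexOn_exp.2 (Set.mem_univ 0) (Set.mem_univ (-η)) (sub_nonneg.2 hx.2) hx.1
    (sub_add_cancel 1 x)
  simp only [smul_eq_mul, mul_zero, zero_add, Real.exp_zero, mul_one] at h
  rw [mul_comm x (-η)] at h
  linarith

/-- Scaling the denominator by `exp a` shifts `u * log (u / w)` by `-u * a`. -/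
theorem mul_log_div_mul_exp (u a : ℝ) {w : ℝ} (hw : w ≠ 0) :
    u * Real.log (u / (w * Real.exp a)) = u * Real.log (u / w) - u * a := by
  rcases eq_or_ne u 0 with rfl | hu
  · simp
  · rw [← div_div, Real.log_div (div_ne_zero hu hw) (Real.exp_ne_zero a), Real.log_exp, mul_sub]

theorem hedge_per_trial_progress (d : ℕ) (hd : 0 < d)
    (η : ℝ) (hη : 0 < η)
    (L : Fin d → ℝ) (hL : ∀ i, L i ∈ Set.Icc (0 : ℝ) 1)
    (w : Fin d → ℝ) (hw : ∀ i, 0 < w i)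
    (u : Fin d → ℝ) (hu : ∀ i, 0 ≤ u i)
    (wt : Fin d → ℝ) (hwt : ∀ i, wt i = w i * Real.exp (-η * L i)) :
    (1 - Real.exp (-η)) * ∑ i, w i * L i ≤
      unnormRelEntropy u w - unnormRelEntropy u wt + η * ∑ i, u i * L i := by
  unfold unnormRelEntropy
  rw [Finset.mul_sum, Finset.mul_sum, ← Finset.sum_sub_distrib, ← Finset.sum_add_distrib]
  refine Finset.sum_le_sum fun i _ => ?_
  rw [hwt i, mul_log_div_mul_exp _ _ (hw i).ne']
  have h := mul_le_mul_of_nonneg_left (exp_neg_mul_le_chord η (hL i)) (hw i).le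
  linarith
end

section
/- Let L* > 0 and D > 0 be real numbers and set η = log(1 + √(2D/L*)). Then (η·L* + D)/(1 − exp(−η)) ≤ L* + √(2·L*·D) + D. -/
/-- The bound `x ≤ sinh x` at `x = log (1 + s)`, cleared of denominators. -/
theorem log_one_add_mul_le {s : ℝ} (hs : 0 ≤ s) :
    Real.log (1 + s) * (1 + s) ≤ s + s ^ 2 / 2 := by
  have h1 : 0 < 1 + s := by linarith
  have h := Real.self_le_sinh_iff.2 (Real.log_nonneg (by linarith : 1 ≤ 1 + s))
  rw [Real.sinh_log h1] at h
  calc Real.log (1 + s) * (1 + s) ≤ (1 + s - (1 + s)⁻¹) / 2 * (1 + s) := by gcongr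
    _ = s + s ^ 2 / 2 := by field_simp; ring

theorem learning_rate_tuning (Lstar D : ℝ) (hL : 0 < Lstar) (hD : 0 < D)
    (η : ℝ) (hη : η = Real.log (1 + Real.sqrt (2 * D / Lstar))) :
    (η * Lstar + D) / (1 - Real.exp (-η)) ≤ Lstar + Real.sqrt (2 * Lstar * D) + D := by
  set s := Real.sqrt (2 * D / Lstar) with hs_def
  have hs : 0 < s := Real.sqrt_pos.2 (by positivity)
  have hD_eq : D = Lstar * s ^ 2 / 2 := by
    rw [hs_def, Real.sq_sqrt (by positivity)]
    field_simp
  have h_sqrt : Real.sqrt (2 * Lstar * D) = Lstar * s := by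
    rw [hD_eq, show 2 * Lstar * (Lstar * s ^ 2 / 2) = (Lstar * s) ^ 2 by ring,
      Real.sqrt_sq (by positivity)]
  have h_exp : 1 - Real.exp (-η) = s / (1 + s) := by
    rw [hη, Real.exp_neg, Real.exp_log (by positivity)]
    field_simp
    ring
  have h_log := log_one_add_mul_le hs.le
  rw [← hη] at h_log
  rw [h_sqrt, h_exp, div_le_iff₀ (by positivity), ← mul_div_assoc, le_div_iff₀ (by positivity),
    hD_eq]
  linarith [mul_le_mul_of_nonneg_left h_log hL.le]
end

section
/- Let d be a positive integer, w ∈ ℝ^d with w_i > 0 for all i, a ∈ ℝ^d, a_0 ∈ ℝ, and suppose ρ > 0 satisfies ∑_{i=1}^d a_i·w_i·ρ^{a_i} = a_0. Define w* ∈ ℝ^d by w*_i = w_i·ρ^{a_i}. Then w* satisfies ∑_{i=1}^d a_i·w*_i = a_0, and for every u ∈ ℝ^d with u_i > 0 for all i and ∑_{i=1}^d a_i·u_i = a_0, it holds that Δ(u‖w) = Δ(u‖w*) + Δ(w*‖w); in particular Δ(w*‖w) ≤ Δ(u‖w), so w* is the Bregman projection of w onto the hyperplane {u : aᵀu = a_0}.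 -/
/-- The unnormalized relative entropy of positive vectors is nonnegative. -/
theorem unnormRelEntropy_nonneg {d : ℕ} {u w : Fin d → ℝ} (hu : ∀ i, 0 < u i)
    (hw : ∀ i, 0 < w i) : 0 ≤ unnormRelEntropy u w := by
  refine Finset.sum_nonneg fun i _ => ?_
  have hlog := mul_le_mul_of_nonneg_left
    (Real.one_sub_inv_le_log_of_pos (div_pos (hu i) (hw i))) (hu i).le
  have hmul : u i * (1 - (u i / w i)⁻¹) = u i - w i := by
    have := (hu i).ne'
    field_simp
  linarith

theorem bregman_projection_onto_hyperplane (d : ℕ) (hd : 0 < d)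
    (w : Fin d → ℝ) (hw : ∀ i, 0 < w i)
    (a : Fin d → ℝ) (a₀ : ℝ)
    (ρ : ℝ) (hρ : 0 < ρ) (hroot : ∑ i, a i * w i * ρ ^ (a i) = a₀)
    (wstar : Fin d → ℝ) (hwstar : ∀ i, wstar i = w i * ρ ^ (a i)) :
    (∑ i, a i * wstar i = a₀) ∧
    ∀ u : Fin d → ℝ, (∀ i, 0 < u i) → (∑ i, a i * u i = a₀) →
      unnormRelEntropy u w = unnormRelEntropy u wstar + unnormRelEntropy wstar w ∧
      unnormRelEntropy wstar w ≤ unnormRelEntropy u w := by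
  have hmem : ∑ i, a i * wstar i = a₀ := by
    simp only [hwstar, ← mul_assoc, hroot]
  have hpos : ∀ i, 0 < wstar i := fun i => by
    rw [hwstar]
    exact mul_pos (hw i) (Real.rpow_pos_of_pos hρ _)
  refine ⟨hmem, fun u hu hua => ?_⟩
  have hpyth : unnormRelEntropy u w = unnormRelEntropy u wstar + unnormRelEntropy wstar w := by
    have hlog : ∀ i, Real.log (wstar i) = Real.log (w i) + a i * Real.log ρ := fun i => by
      rw [hwstar, Real.log_mul (hw i).ne' (Real.rpow_pos_of_pos hρ _).ne', Real.log_rpow hρ]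
    have hdiff : unnormRelEntropy u w - (unnormRelEntropy u wstar + unnormRelEntropy wstar w)
        = Real.log ρ * (∑ i, a i * u i - ∑ i, a i * wstar i) := by
      simp only [unnormRelEntropy]
      rw [← Finset.sum_add_distrib, ← Finset.sum_sub_distrib, ← Finset.sum_sub_distrib,
        Finset.mul_sum]
      refine Finset.sum_congr rfl fun i _ => ?_
      rw [Real.log_div (hu i).ne' (hw i).ne', Real.log_div (hu i).ne' (hpos i).ne',
        Real.log_div (hpos i).ne' (hw i).ne', hlog]
      ring
    rw [hua, hmem, sub_self, mul_zero] at hdiff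
    exact sub_eq_zero.mp hdiff
  exact ⟨hpyth, hpyth ▸ le_add_of_nonneg_left (unnormRelEntropy_nonneg hu hpos)⟩
end
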